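/- Let 𝔄 be a unital complex Banach algebra and (A₁, …, Aₙ) an n-tuple in 𝔄. Define recursively H_k := the iterated antisymmetrization of A_k with respect to Q₁, …, Q_{k−1} (that is, H_k is obtained from A_k by successively applying R ↦ ½(R − Qᵢ⁻¹ R Qᵢ) for i = 1, …, k−1), and Q_k := pol H_k, assuming that at each stage the spectrum of H_k is disjoint from ℝ. Then (Q₁, …, Qₙ) is a Clifford system: QᵢQⱼ + QⱼQᵢ = −2δᵢⱼ·1 for all i, j. Moreover, if (A₁, …, Aₙ) is itself a Clifford system, then Qᵢ = Aᵢ for all i. -/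

import Mathlib

/-- The polarization `pol H := (1/(2π)) ∫₀^{2π} ((−sin t)·1 + (cos t)·H)·((cos t)·1 + (sin t)·H)⁻¹ dt`
in a unital complex Banach algebra. -/
noncomputable def pol {𝔄 : Type*} [NormedRing 𝔄] [NormedAlgebra ℂ 𝔄] [CompleteSpace 𝔄]
    (H : 𝔄) : 𝔄 :=
  (2 * Real.pi)⁻¹ • ∫ t in (0:ℝ)..(2 * Real.pi),
    ((-Real.sin t) • (1 : 𝔄) + (Real.cos t) • H) *
      Ring.inverse ((Real.cos t) • (1 : 𝔄) + (Real.sin t) • H)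

/-- The antisymmetrization `R ↦ ½(R − Q⁻¹RQ)` of `R` with respect to `Q`. -/
noncomputable def antisym {𝔄 : Type*} [Ring 𝔄] [Module ℝ 𝔄] (Q R : 𝔄) : 𝔄 :=
  (2⁻¹ : ℝ) • (R - Ring.inverse Q * R * Q)

/-- The iterated antisymmetrization of `X` with respect to `Q 1, …, Q (k-1)`
(successively, starting with `Q 1`). -/
noncomputable def gsAntisym {𝔄 : Type*} [Ring 𝔄] [Module ℝ 𝔄] {n : ℕ}
    (Q : Fin n → 𝔄) (k : Fin n) (X : 𝔄) : 𝔄 :=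
  (List.ofFn fun i : Fin (k : ℕ) => Q (Fin.castLE k.isLt.le i)).foldl
    (fun R q => antisym q R) X

/-- A Clifford system: `QᵢQⱼ + QⱼQᵢ = −2δᵢⱼ·1`. -/
def IsCliffordSystem {𝔄 : Type*} [Ring 𝔄] {n : ℕ} (Q : Fin n → 𝔄) : Prop :=
  ∀ i j, Q i * Q j + Q j * Q i = if i = j then (-2 : 𝔄) else 0

/-- The pencil `(cos t)·1 + (sin t)·H`. -/
noncomputable def polPencil {𝔄 : Type*} [Ring 𝔄] [Module ℝ 𝔄] (H : 𝔄) (t : ℝ) : 𝔄 :=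
  Real.cos t • (1 : 𝔄) + Real.sin t • H

/-- The derivative `(−sin t)·1 + (cos t)·H` of the pencil. -/
noncomputable def polPencilDeriv {𝔄 : Type*} [Ring 𝔄] [Module ℝ 𝔄] (H : 𝔄) (t : ℝ) : 𝔄 :=
  (-Real.sin t) • (1 : 𝔄) + Real.cos t • H

/-- The integrand in the definition of `pol H`. -/
noncomputable def polIntegrand {𝔄 : Type*} [Ring 𝔄] [Module ℝ 𝔄] (H : 𝔄) (t : ℝ) : 𝔄 :=
  polPencilDeriv H t * Ring.inverse (polPencil H t)

section Antisym

variable {𝔄 : Type*} [Ring 𝔄]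

theorem ring_inverse_eq_neg_of_mul_self {q : 𝔄} (hq : q * q = -1) : Ring.inverse q = -q :=
  Ring.inverse_unit ⟨q, -q, by simp [hq], by simp [hq]⟩

theorem ring_inverse_mul_comm {x y : 𝔄} (hx : IsUnit x) (h : x * y = y * x) :
    Ring.inverse x * y = y * Ring.inverse x := by
  obtain ⟨u, rfl⟩ := hx
  rw [Ring.inverse_unit]
  exact (Commute.units_inv_left (show Commute (u : 𝔄) y from h)).eq

variable [Algebra ℝ 𝔄]

theorem antisym_of_mul_self {q : 𝔄} (hq : q * q = -1) (X : 𝔄) :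
    antisym q X = (2⁻¹ : ℝ) • (X + q * X * q) := by
  simp [antisym, ring_inverse_eq_neg_of_mul_self hq]

theorem mul_antisym_self {q : 𝔄} (hq : q * q = -1) (X : 𝔄) :
    q * antisym q X = -(antisym q X * q) := by
  have h1 : q * (q * X * q) = -(X * q) := by
    rw [← mul_assoc, ← mul_assoc, hq]; simp
  have h2 : q * X * q * q = -(q * X) := by
    rw [mul_assoc, hq]; simp
  rw [antisym_of_mul_self hq, mul_smul_comm, smul_mul_assoc, ← smul_neg, mul_add, add_mul, h1, h2]
  congr 1
  abel

theorem mul_antisym_of_anticommute {p q X : 𝔄} (hq : q * q = -1) (hpq : p * q = -(q * p))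
    (hpX : p * X = -(X * p)) : p * antisym q X = -(antisym q X * p) := by
  have h : p * (q * X * q) = -(q * X * q * p) := by
    calc p * (q * X * q) = p * q * X * q := by noncomm_ring
      _ = -(q * (p * X) * q) := by rw [hpq]; noncomm_ring
      _ = q * X * (p * q) := by rw [hpX]; noncomm_ring
      _ = -(q * X * q * p) := by rw [hpq]; noncomm_ring
  rw [antisym_of_mul_self hq, mul_smul_comm, smul_mul_assoc, ← smul_neg, mul_add, add_mul, h, hpX,
    neg_add]

theorem antisym_eq_self {q X : 𝔄} (hq : q * q = -1) (hqX : q * X = -(X * q)) :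
    antisym q X = X := by
  have h : q * X * q = X := by rw [hqX, neg_mul, mul_assoc, hq]; simp
  rw [antisym_of_mul_self hq, h, ← two_smul ℝ X, smul_smul]
  norm_num

theorem mul_foldl_antisym_of_anticommute {p : 𝔄} (l : List 𝔄) (hl : ∀ q ∈ l, q * q = -1)
    (hp : ∀ q ∈ l, p * q = -(q * p)) (X : 𝔄) (hX : p * X = -(X * p)) :
    p * l.foldl (fun R q => antisym q R) X = -(l.foldl (fun R q => antisym q R) X * p) := by
  induction l generalizing X with
  | nil => simpa using hX
  | cons q l ih =>
    rw [List.forall_mem_cons] at hl hp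
    exact ih hl.2 hp.2 _ (mul_antisym_of_anticommute hl.1 hp.1 hX)

theorem mul_foldl_antisym_of_mem (l : List 𝔄) (hl : ∀ q ∈ l, q * q = -1)
    (hp : l.Pairwise fun p q => p * q = -(q * p)) (X : 𝔄) {p : 𝔄} (hpl : p ∈ l) :
    p * l.foldl (fun R q => antisym q R) X = -(l.foldl (fun R q => antisym q R) X * p) := by
  induction l generalizing X with
  | nil => simp at hpl
  | cons q l ih =>
    rw [List.forall_mem_cons] at hl
    rw [List.pairwise_cons] at hp
    rcases List.mem_cons.1 hpl with rfl | h
    · exact mul_foldl_antisym_of_anticommute l hl.2 hp.1 _ (mul_antisym_self hl.1 X)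
    · exact ih hl.2 hp.2 _ h

theorem foldl_antisym_eq_self (l : List 𝔄) (hl : ∀ q ∈ l, q * q = -1) (X : 𝔄)
    (hX : ∀ q ∈ l, q * X = -(X * q)) : l.foldl (fun R q => antisym q R) X = X := by
  induction l with
  | nil => rfl
  | cons q l ih =>
    rw [List.forall_mem_cons] at hl hX
    rw [List.foldl_cons, antisym_eq_self hl.1 hX.1]
    exact ih hl.2 hX.2

theorem mul_gsAntisym {n : ℕ} (Q : Fin n → 𝔄) (k : Fin n) (hQ : ∀ i < k, Q i * Q i = -1)
    (hp : ∀ j < k, ∀ i < j, Q i * Q j = -(Q j * Q i)) (X : 𝔄) (i : Fin n) (hi : i < k) :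
    Q i * gsAntisym Q k X = -(gsAntisym Q k X * Q i) := by
  refine mul_foldl_antisym_of_mem _ ?_ ?_ X ?_
  · rw [List.forall_mem_ofFn_iff]
    exact fun j => hQ _ j.isLt
  · rw [List.pairwise_ofFn]
    exact fun a b hab => hp _ b.isLt _ hab
  · exact List.mem_ofFn.2 ⟨⟨i, hi⟩, rfl⟩

theorem gsAntisym_eq_self {n : ℕ} (Q : Fin n → 𝔄) (k : Fin n) (hQ : ∀ i < k, Q i * Q i = -1)
    (X : 𝔄) (hX : ∀ i < k, Q i * X = -(X * Q i)) : gsAntisym Q k X = X := by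
  refine foldl_antisym_eq_self _ ?_ X ?_
  · rw [List.forall_mem_ofFn_iff]
    exact fun j => hQ _ j.isLt
  · rw [List.forall_mem_ofFn_iff]
    exact fun j => hX _ j.isLt

theorem polPencil_mul_comm (H : 𝔄) (s t : ℝ) :
    polPencil H s * polPencil H t = polPencil H t * polPencil H s := by
  simp only [polPencil, add_mul, mul_add, smul_mul_smul_comm, one_mul, mul_one]
  module

theorem polPencilDeriv_mul_comm (H : 𝔄) (s t : ℝ) :
    polPencilDeriv H s * polPencil H t = polPencil H t * polPencilDeriv H s := by
  simp only [polPencil, polPencilDeriv, add_mul, mul_add, smul_mul_smul_comm, one_mul, mul_one]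
  module

theorem sin_smul_polPencil_add (H : 𝔄) (t u : ℝ) :
    Real.sin u • (polPencil H t * polPencil H (t + u) +
        polPencilDeriv H t * polPencilDeriv H (t + u)) =
      Real.cos u • (polPencilDeriv H t * polPencil H (t + u) -
        polPencil H t * polPencilDeriv H (t + u)) := by
  simp only [polPencil, polPencilDeriv, add_mul, mul_add, smul_mul_smul_comm, one_mul, mul_one,
    Real.sin_add, Real.cos_add]
  match_scalars <;> ring

/-- The subtraction formula for the tangent, satisfied by the integrand of `pol H`. -/
theorem sin_smul_one_add_polIntegrand_mul {H : 𝔄} (hH : ∀ t, IsUnit (polPencil H t)) (t u : ℝ) :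
    Real.sin u • (1 + polIntegrand H t * polIntegrand H (t + u)) =
      Real.cos u • (polIntegrand H t - polIntegrand H (t + u)) := by
  have key := congrArg
    (· * (Ring.inverse (polPencil H t) * Ring.inverse (polPencil H (t + u))))
    (sin_smul_polPencil_add H t u)
  have hx := Ring.mul_inverse_cancel _ (hH t)
  have hy := Ring.mul_inverse_cancel _ (hH (t + u))
  have c1 : Ring.inverse (polPencil H t) * polPencil H (t + u) =
      polPencil H (t + u) * Ring.inverse (polPencil H t) :=
    ring_inverse_mul_comm (hH t) (polPencil_mul_comm H t (t + u))
  have c2 : Ring.inverse (polPencil H t) * polPencilDeriv H (t + u) =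
      polPencilDeriv H (t + u) * Ring.inverse (polPencil H t) :=
    ring_inverse_mul_comm (hH t) (polPencilDeriv_mul_comm H (t + u) t).symm
  simp only [polIntegrand]
  generalize polPencil H t = x at *
  generalize polPencil H (t + u) = y at *
  generalize polPencilDeriv H t = x' at *
  generalize polPencilDeriv H (t + u) = y' at *
  generalize Ring.inverse x = a at *
  generalize Ring.inverse y = b at *
  have e1 : x * y * (a * b) = 1 := by
    rw [mul_assoc, ← mul_assoc y, ← c1, mul_assoc a, hy, mul_one, hx]
  have e2 : x' * y' * (a * b) = x' * a * (y' * b) := by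
    rw [mul_assoc, ← mul_assoc y', ← c2]; noncomm_ring
  have e3 : x' * y * (a * b) = x' * a := by
    rw [mul_assoc, ← mul_assoc y, ← c1, mul_assoc a, hy, mul_one]
  have e4 : x * y' * (a * b) = y' * b := by
    rw [mul_assoc, ← mul_assoc y', ← c2, mul_assoc a, ← mul_assoc, hx, one_mul]
  simpa only [smul_mul_assoc, add_mul, sub_mul, e1, e2, e3, e4] using key

theorem polIntegrand_add_two_pi (H : 𝔄) : Function.Periodic (polIntegrand H) (2 * Real.pi) := by
  intro t
  simp [polIntegrand, polPencil, polPencilDeriv]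

theorem mul_polIntegrand_of_anticommute {q H : 𝔄} (hH : ∀ t, IsUnit (polPencil H t))
    (hq : q * H = -(H * q)) (t : ℝ) :
    q * polIntegrand H t = -(polIntegrand H (-t) * q) := by
  have h1 : q * polPencil H t = polPencil H (-t) * q := by
    simp [polPencil, mul_add, add_mul, hq]
  have h2 : q * polPencilDeriv H t = -(polPencilDeriv H (-t) * q) := by
    simp [polPencilDeriv, mul_add, add_mul, hq]
    abel
  have h3 : q * Ring.inverse (polPencil H t) = Ring.inverse (polPencil H (-t)) * q := by
    rw [← (hH (-t)).mul_right_inj, ← mul_assoc, ← h1, ← mul_assoc, mul_assoc q,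
      Ring.mul_inverse_cancel _ (hH t), Ring.mul_inverse_cancel _ (hH (-t)), mul_one, one_mul]
  rw [polIntegrand, ← mul_assoc, h2, neg_mul, mul_assoc, h3, polIntegrand, mul_assoc]

theorem polIntegrand_eq_self {H : 𝔄} (hH : H * H = -1) (t : ℝ) : polIntegrand H t = H := by
  have h1 : Ring.inverse (polPencil H t) = Real.cos t • (1 : 𝔄) - Real.sin t • H := by
    refine Ring.inverse_unit ⟨polPencil H t, Real.cos t • (1 : 𝔄) - Real.sin t • H, ?_, ?_⟩ <;>
    · simp only [polPencil, add_mul, mul_add, mul_sub, sub_mul, smul_mul_smul_comm, one_mul,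
        mul_one, hH]
      match_scalars
      · linear_combination Real.sin_sq_add_cos_sq t
      · ring
  rw [polIntegrand, h1]
  simp only [polPencilDeriv, add_mul, mul_sub, smul_mul_smul_comm, one_mul, mul_one, hH]
  match_scalars
  · ring
  · linear_combination Real.sin_sq_add_cos_sq t

end Antisym

section Pol

variable {𝔄 : Type*} [NormedRing 𝔄] [NormedAlgebra ℂ 𝔄]

theorem isUnit_polPencil {H : 𝔄} (hH : ∀ z ∈ spectrum ℂ H, z.im ≠ 0) (t : ℝ) :
    IsUnit (polPencil H t) := by
  rcases eq_or_ne (Real.sin t) 0 with hs | hs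
  · have hc : Real.cos t ≠ 0 := fun hc => by
      simpa [hs, hc] using Real.sin_sq_add_cos_sq t
    have h : polPencil H t = algebraMap ℝ 𝔄 (Real.cos t) := by
      simp [polPencil, hs, Algebra.algebraMap_eq_smul_one]
    rw [h]
    exact (IsUnit.mk0 _ hc).map _
  · have h : ((-(Real.cos t / Real.sin t) : ℝ) : ℂ) ∉ spectrum ℂ H :=
      fun h => hH _ h (Complex.ofReal_im _)
    rw [spectrum.notMem_iff] at h
    have e : polPencil H t = algebraMap ℝ 𝔄 (-Real.sin t) *
        (algebraMap ℂ 𝔄 ((-(Real.cos t / Real.sin t) : ℝ) : ℂ) - H) := by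
      rw [Algebra.algebraMap_eq_smul_one, Algebra.algebraMap_eq_smul_one, Complex.coe_smul,
        polPencil, smul_mul_assoc, one_mul, smul_sub, smul_smul]
      match_scalars <;> field_simp
    rw [e]
    exact ((IsUnit.mk0 _ (neg_ne_zero.2 hs)).map _).mul h

theorem integral_polIntegrand_add (H : 𝔄) (u : ℝ) :
    ∫ t in (0 : ℝ)..(2 * Real.pi), polIntegrand H (t + u) =
      ∫ t in (0 : ℝ)..(2 * Real.pi), polIntegrand H t := by
  have := (polIntegrand_add_two_pi H).intervalIntegral_add_eq u 0
  rw [intervalIntegral.integral_comp_add_right, zero_add, add_comm _ u, this, zero_add]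

theorem integral_polIntegrand_neg (H : 𝔄) :
    ∫ t in (0 : ℝ)..(2 * Real.pi), polIntegrand H (-t) =
      ∫ t in (0 : ℝ)..(2 * Real.pi), polIntegrand H t := by
  have := (polIntegrand_add_two_pi H).intervalIntegral_add_eq (-(2 * Real.pi)) 0
  rw [intervalIntegral.integral_comp_neg]
  simpa using this

variable [CompleteSpace 𝔄]

theorem pol_eq_polIntegrand (H : 𝔄) :
    pol H = (2 * Real.pi)⁻¹ • ∫ t in (0 : ℝ)..(2 * Real.pi), polIntegrand H t := rfl

theorem continuous_polIntegrand {H : 𝔄} (hH : ∀ t, IsUnit (polPencil H t)) :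
    Continuous (polIntegrand H) := by
  have h1 : Continuous (polPencilDeriv H) := by unfold polPencilDeriv; fun_prop
  have h2 : Continuous (polPencil H) := by unfold polPencil; fun_prop
  refine h1.mul (continuous_iff_continuousAt.2 fun t => ?_)
  obtain ⟨x, hx⟩ := hH t
  have := NormedRing.inverse_continuousAt x
  rw [hx] at this
  exact ContinuousAt.comp this h2.continuousAt

theorem pol_eq_self {H : 𝔄} (hH : H * H = -1) : pol H = H := by
  rw [pol_eq_polIntegrand]
  simp only [polIntegrand_eq_self hH, intervalIntegral.integral_const, sub_zero]
  rw [inv_smul_smul₀ (by positivity)]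

theorem intervalIntegral_const_mul_of_continuous {f : ℝ → 𝔄} (hf : Continuous f) (r : 𝔄)
    (a b : ℝ) : ∫ t in a..b, r * f t = r * ∫ t in a..b, f t :=
  (ContinuousLinearMap.mul ℂ 𝔄 r).intervalIntegral_comp_comm (hf.intervalIntegrable a b)

theorem intervalIntegral_mul_const_of_continuous {f : ℝ → 𝔄} (hf : Continuous f) (r : 𝔄)
    (a b : ℝ) : ∫ t in a..b, f t * r = (∫ t in a..b, f t) * r :=
  ((ContinuousLinearMap.mul ℂ 𝔄).flip r).intervalIntegral_comp_comm (hf.intervalIntegrable a b)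

theorem mul_pol_of_anticommute {q H : 𝔄} (hH : ∀ t, IsUnit (polPencil H t))
    (hq : q * H = -(H * q)) : q * pol H = -(pol H * q) := by
  have hc := continuous_polIntegrand hH
  have hc' : Continuous fun t => polIntegrand H (-t) := hc.comp continuous_neg
  rw [pol_eq_polIntegrand, mul_smul_comm, smul_mul_assoc, ← smul_neg,
    ← intervalIntegral_const_mul_of_continuous hc]
  simp only [mul_polIntegrand_of_anticommute hH hq]
  rw [intervalIntegral.integral_neg,
    intervalIntegral_mul_const_of_continuous hc', integral_polIntegrand_neg]

/-- For the integrand `f` of `pol H`, the function `t ↦ f t * f (t + u)` has mean value `-1`. -/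
theorem integral_polIntegrand_mul_shift {H : 𝔄} (hH : ∀ t, IsUnit (polPencil H t)) {u : ℝ}
    (hu : Real.sin u ≠ 0) :
    ∫ t in (0 : ℝ)..(2 * Real.pi), polIntegrand H t * polIntegrand H (t + u) =
      -((2 * Real.pi) • (1 : 𝔄)) := by
  have hc := continuous_polIntegrand hH
  have hc' : Continuous fun t => polIntegrand H (t + u) := hc.comp (continuous_add_const u)
  have h : ∀ t, polIntegrand H t * polIntegrand H (t + u) =
      ((Real.sin u)⁻¹ * Real.cos u) • (polIntegrand H t - polIntegrand H (t + u)) - 1 := by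
    intro t
    rw [mul_smul, ← sin_smul_one_add_polIntegrand_mul hH, inv_smul_smul₀ hu, add_sub_cancel_left]
  have hd : Continuous fun t => ((Real.sin u)⁻¹ * Real.cos u) •
      (polIntegrand H t - polIntegrand H (t + u)) := (hc.sub hc').const_smul _
  simp only [h]
  rw [intervalIntegral.integral_sub (hd.intervalIntegrable _ _) intervalIntegrable_const,
    intervalIntegral.integral_smul,
    intervalIntegral.integral_sub (hc.intervalIntegrable _ _) (hc'.intervalIntegrable _ _),
    integral_polIntegrand_add, sub_self, smul_zero, intervalIntegral.integral_const, sub_zero,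
    zero_sub]

theorem ae_sin_ne_zero : ∀ᵐ u : ℝ, Real.sin u ≠ 0 := by
  have h : {u : ℝ | Real.sin u = 0}.Countable :=
    (Set.countable_range fun n : ℤ => (n : ℝ) * Real.pi).mono
      fun u hu => Real.sin_eq_zero_iff.1 hu
  exact h.ae_notMem MeasureTheory.volume

theorem pol_mul_self {H : 𝔄} (hH : ∀ t, IsUnit (polPencil H t)) : pol H * pol H = -1 := by
  have hc := continuous_polIntegrand hH
  have hcu (t : ℝ) : Continuous fun u => polIntegrand H (t + u) := hc.comp (continuous_const_add t)
  have key : (∫ t in (0 : ℝ)..(2 * Real.pi), polIntegrand H t) *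
      (∫ t in (0 : ℝ)..(2 * Real.pi), polIntegrand H t) =
      -((2 * Real.pi) • (2 * Real.pi) • (1 : 𝔄)) := by
    calc
      _ = ∫ t in (0 : ℝ)..(2 * Real.pi), ∫ u in (0 : ℝ)..(2 * Real.pi),
            polIntegrand H t * polIntegrand H (t + u) := by
        rw [← intervalIntegral_mul_const_of_continuous hc]
        refine intervalIntegral.integral_congr fun t _ => ?_
        simp only [intervalIntegral_const_mul_of_continuous (hcu t)]
        simp only [add_comm t, integral_polIntegrand_add]
      _ = ∫ u in (0 : ℝ)..(2 * Real.pi), ∫ t in (0 : ℝ)..(2 * Real.pi),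
            polIntegrand H t * polIntegrand H (t + u) := by
        have hF : Continuous (Function.uncurry fun t u : ℝ =>
            polIntegrand H t * polIntegrand H (t + u)) :=
          (hc.comp continuous_fst).mul (hc.comp continuous_add)
        refine MeasureTheory.intervalIntegral_intervalIntegral_swap ?_
        exact (hF.continuousOn.integrableOn_compact
          (isCompact_uIcc.prod isCompact_uIcc)).mono_set
          (Set.prod_mono Set.uIoc_subset_uIcc Set.uIoc_subset_uIcc)
      _ = ∫ _ in (0 : ℝ)..(2 * Real.pi), -((2 * Real.pi) • (1 : 𝔄)) := by
        refine intervalIntegral.integral_congr_ae ?_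
        filter_upwards [ae_sin_ne_zero] with u hu _
        exact integral_polIntegrand_mul_shift hH hu
      _ = _ := by simp only [intervalIntegral.integral_const, sub_zero, smul_neg]
  rw [pol_eq_polIntegrand, smul_mul_smul_comm, key, mul_smul, smul_neg, smul_neg,
    inv_smul_smul₀ (by positivity), inv_smul_smul₀ (by positivity)]

end Pol

theorem stmt10 {𝔄 : Type*} [NormedRing 𝔄] [NormedAlgebra ℂ 𝔄] [CompleteSpace 𝔄]
    {n : ℕ} (A Q H : Fin n → 𝔄)
    (hH : ∀ k : Fin n, H k = gsAntisym Q k (A k))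
    (hspec : ∀ k : Fin n, ∀ z ∈ spectrum ℂ (H k), z.im ≠ 0)
    (hQ : ∀ k : Fin n, Q k = pol (H k)) :
    IsCliffordSystem Q ∧ (IsCliffordSystem A → ∀ i, Q i = A i) := by
  have hunit k := isUnit_polPencil (hspec k)
  have hsq : ∀ k, Q k * Q k = -1 := fun k => by rw [hQ k, pol_mul_self (hunit k)]
  have hanti : ∀ k, ∀ i < k, Q i * Q k = -(Q k * Q i) := by
    intro k
    induction k using WellFoundedLT.induction with
    | ind k ih =>
      intro i hi
      have h := mul_gsAntisym Q k (fun i _ => hsq i) ih (A k) i hi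
      rw [← hH k] at h
      have h' := mul_pol_of_anticommute (hunit k) h
      rwa [← hQ k] at h'
  refine ⟨fun i j => ?_, fun hA k => ?_⟩
  · rcases lt_trichotomy i j with h | rfl | h
    · simp [h.ne, hanti j i h]
    · rw [if_pos rfl, hsq]; norm_num
    · simp [h.ne', hanti i j h]
  · induction k using WellFoundedLT.induction with
    | ind k ih =>
      have hAsq : A k * A k = -1 := by
        have h := congrArg ((2⁻¹ : ℝ) • ·) (hA k k)
        have h2 : (-2 : 𝔄) = (2 : ℝ) • (-1 : 𝔄) := by rw [two_smul]; norm_num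
        simpa only [if_pos, ← two_smul ℝ (A k * A k), h2,
          inv_smul_smul₀ (two_ne_zero : (2 : ℝ) ≠ 0)] using h
      have hAk : H k = A k := by
        rw [hH k]
        refine gsAntisym_eq_self Q k (fun i _ => hsq i) (A k) fun i hi => ?_
        rw [ih i hi]
        have h := hA i k
        rw [if_neg hi.ne] at h
        exact eq_neg_of_add_eq_zero_left h
      rw [hQ k, hAk, pol_eq_self hAsq]
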